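/- Hoeffding's hypothesis-testing exponent (converse direction via Stein's lemma): for any sequence of tests C_n ⊆ A^n with limsup_n (1/n) log P₀^n(C_n) ≤ −r, where 0 < r < H(P₁‖P₀), the type-II error β_n = P₁^n(C_n^c) satisfies limsup_n −(1/n) log β_n ≤ inf{ H(Q‖P₁) : Q with H(Q‖P₀) < r }. -/

import Mathlib

open Finset Filter

/-- Product probability of a subset of `A^n`. -/
noncomputable def prodProb {A : Type*} [Fintype A] (P : A → ℝ) (n : ℕ)
    (C : Finset (Fin n → A)) : ℝ := ∑ x ∈ C, ∏ i, P (x i)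

/-- Base-2 relative entropy. -/
noncomputable def relEnt {A : Type*} [Fintype A] (Q P : A → ℝ) : ℝ :=
  ∑ a, Q a * Real.logb 2 (Q a / P a)

lemma sum_pi_succ {A : Type*} [Fintype A] (n : ℕ) (F : (Fin (n + 1) → A) → ℝ) :
    ∑ x, F x = ∑ a, ∑ x : Fin n → A, F (Fin.cons a x) := by
  rw [← (Fin.consEquiv (fun _ : Fin (n + 1) => A)).sum_comp, Fintype.sum_prod_type]
  rfl

lemma sum_prod_eq_one {A : Type*} [Fintype A] (Q : A → ℝ) (hQ : ∑ a, Q a = 1) (n : ℕ) :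
    ∑ x : Fin n → A, ∏ i, Q (x i) = 1 := by
  induction n with
  | zero => simp
  | succ n ih =>
    rw [sum_pi_succ]
    simp only [Fin.prod_univ_succ, Fin.cons_zero, Fin.cons_succ]
    simp only [← Finset.mul_sum, ih, mul_one, hQ]

/-- The variance of a sum of i.i.d. centred variables is the sum of the variances; the mean
vanishes. -/
lemma sum_prod_mul_sum_moments {A : Type*} [Fintype A] (Q : A → ℝ) (hQ : ∑ a, Q a = 1)
    (g : A → ℝ) (hg : ∑ a, Q a * g a = 0) (n : ℕ) :
    ∑ x : Fin n → A, (∏ i, Q (x i)) * (∑ i, g (x i)) = 0 ∧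
      ∑ x : Fin n → A, (∏ i, Q (x i)) * (∑ i, g (x i)) ^ 2 = n * ∑ a, Q a * g a ^ 2 := by
  induction n with
  | zero => simp
  | succ n ih =>
    have h1 := sum_prod_eq_one Q hQ n
    obtain ⟨h2, h3⟩ := ih
    constructor
    · rw [sum_pi_succ]
      simp only [Fin.prod_univ_succ, Fin.sum_univ_succ, Fin.cons_zero, Fin.cons_succ]
      have (a : A) : ∑ x : Fin n → A, Q a * (∏ i, Q (x i)) * (g a + ∑ i, g (x i))
          = Q a * g a := by
        calc _ = Q a * g a * ∑ x : Fin n → A, (∏ i, Q (x i))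
              + Q a * ∑ x : Fin n → A, (∏ i, Q (x i)) * (∑ i, g (x i)) := by
              rw [Finset.mul_sum, Finset.mul_sum, ← Finset.sum_add_distrib]
              exact Finset.sum_congr rfl fun x _ => by ring
          _ = _ := by rw [h1, h2]; ring
      simp only [this, hg]
    · rw [sum_pi_succ]
      simp only [Fin.prod_univ_succ, Fin.sum_univ_succ, Fin.cons_zero, Fin.cons_succ]
      have (a : A) : ∑ x : Fin n → A, Q a * (∏ i, Q (x i)) * (g a + ∑ i, g (x i)) ^ 2
          = Q a * g a ^ 2 + Q a * (n * ∑ a, Q a * g a ^ 2) := by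
        calc _ = Q a * g a ^ 2 * ∑ x : Fin n → A, (∏ i, Q (x i))
              + 2 * Q a * g a * ∑ x : Fin n → A, (∏ i, Q (x i)) * (∑ i, g (x i))
              + Q a * ∑ x : Fin n → A, (∏ i, Q (x i)) * (∑ i, g (x i)) ^ 2 := by
              rw [Finset.mul_sum, Finset.mul_sum, Finset.mul_sum, ← Finset.sum_add_distrib,
                ← Finset.sum_add_distrib]
              exact Finset.sum_congr rfl fun x _ => by ring
          _ = _ := by rw [h1, h2, h3]; ring
      simp only [this, Finset.sum_add_distrib, ← Finset.sum_mul, hQ]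
      push_cast
      ring

lemma prod_le_rpow_mul_prod {A : Type*} (Q P : A → ℝ) (hQ : ∀ a, 0 ≤ Q a)
    (hP : ∀ a, 0 < P a) {n : ℕ} (x : Fin n → A) (t : ℝ)
    (h : ∑ i, Real.logb 2 (Q (x i) / P (x i)) ≤ t) :
    ∏ i, Q (x i) ≤ 2 ^ t * ∏ i, P (x i) := by
  have hPp : 0 < ∏ i, P (x i) := Finset.prod_pos fun i _ => hP _
  by_cases h0 : ∃ i, Q (x i) = 0
  · obtain ⟨i, hi⟩ := h0
    rw [Finset.prod_eq_zero (Finset.mem_univ i) hi]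
    positivity
  · push Not at h0
    have hq (i : Fin n) : 0 < Q (x i) := lt_of_le_of_ne (hQ _) (h0 i).symm
    rw [← div_le_iff₀ hPp, ← Finset.prod_div_distrib]
    rw [← Real.logb_prod _ _ fun i _ => (div_pos (hq i) (hP _)).ne'] at h
    exact (Real.logb_le_iff_le_rpow one_lt_two
      (Finset.prod_pos fun i _ => div_pos (hq i) (hP _))).1 h

lemma prodProb_nonneg {A : Type*} [Fintype A] (P : A → ℝ) (hP : ∀ a, 0 < P a) (n : ℕ)
    (C : Finset (Fin n → A)) : 0 ≤ prodProb P n C :=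
  Finset.sum_nonneg fun _ _ => Finset.prod_nonneg fun _ _ => (hP _).le

lemma prodProb_le_one {A : Type*} [Fintype A] (P : A → ℝ) (hP : ∀ a, 0 < P a)
    (hPsum : ∑ a, P a = 1) (n : ℕ) (C : Finset (Fin n → A)) : prodProb P n C ≤ 1 := by
  rw [← sum_prod_eq_one P hPsum n]
  exact Finset.sum_le_sum_of_subset_of_nonneg (Finset.subset_univ _)
    fun _ _ _ => Finset.prod_nonneg fun _ _ => (hP _).le

/-- Change of measure: for any test, the reference measure `Q` cannot make both error
probabilities small beyond the exponents given by the relative entropies. -/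
lemma one_le_change_of_measure {A : Type*} [Fintype A] [DecidableEq A]
    (P₀ P₁ Q : A → ℝ) (hP₀ : ∀ a, 0 < P₀ a) (hP₁ : ∀ a, 0 < P₁ a)
    (hQ : ∀ a, 0 ≤ Q a) (hQsum : ∑ a, Q a = 1) (δ : ℝ) (hδ : 0 < δ) :
    ∃ V : ℝ, ∀ n : ℕ, 0 < n → ∀ C : Finset (Fin n → A),
      1 ≤ V / n + 2 ^ (n * (relEnt Q P₀ + δ)) * prodProb P₀ n C
        + 2 ^ (n * (relEnt Q P₁ + δ)) * prodProb P₁ n Cᶜ := by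
  let g (P : A → ℝ) (a : A) : ℝ := Real.logb 2 (Q a / P a) - relEnt Q P
  have hg (P : A → ℝ) : ∑ a, Q a * g P a = 0 := by
    simp only [g, mul_sub, Finset.sum_sub_distrib, ← Finset.sum_mul, hQsum]
    simp [relEnt]
  refine ⟨(∑ a, Q a * g P₀ a ^ 2 + ∑ a, Q a * g P₁ a ^ 2) / δ ^ 2, fun n hn C => ?_⟩
  have hn' : (0 : ℝ) < n := by exact_mod_cast hn
  have hw (x : Fin n → A) : 0 ≤ ∏ i, Q (x i) := Finset.prod_nonneg fun _ _ => hQ _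
  have key (P : A → ℝ) (hP : ∀ a, 0 < P a) (x : Fin n → A) :
      ∏ i, Q (x i) ≤ (∏ i, Q (x i)) * (∑ i, g P (x i)) ^ 2 / (n * δ) ^ 2
        + 2 ^ (n * (relEnt Q P + δ)) * ∏ i, P (x i) := by
    have hp : 0 < ∏ i, P (x i) := Finset.prod_pos fun _ _ => hP _
    by_cases h : ∑ i, g P (x i) ≤ n * δ
    · refine (prod_le_rpow_mul_prod Q P hQ hP x (n * (relEnt Q P + δ)) ?_).trans ?_
      · simp only [g, Finset.sum_sub_distrib, Finset.sum_const, Finset.card_univ,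
          Fintype.card_fin, nsmul_eq_mul] at h
        linarith
      · have := hw x
        have : 0 ≤ (∏ i, Q (x i)) * (∑ i, g P (x i)) ^ 2 / (n * δ) ^ 2 := by positivity
        linarith
    · push Not at h
      have h1 : ∏ i, Q (x i) ≤ (∏ i, Q (x i)) * (∑ i, g P (x i)) ^ 2 / (n * δ) ^ 2 := by
        rw [le_div_iff₀ (by positivity)]
        exact mul_le_mul_of_nonneg_left (by gcongr) (hw x)
      have : 0 ≤ (2 : ℝ) ^ (n * (relEnt Q P + δ)) * ∏ i, P (x i) := by positivity
      linarith
  have part (P : A → ℝ) (hP : ∀ a, 0 < P a) (D : Finset (Fin n → A)) :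
      ∑ x ∈ D, ∏ i, Q (x i) ≤ (∑ a, Q a * g P a ^ 2) / δ ^ 2 / n
        + 2 ^ (n * (relEnt Q P + δ)) * prodProb P n D := by
    refine (Finset.sum_le_sum fun x _ => key P hP x).trans ?_
    rw [Finset.sum_add_distrib, ← Finset.mul_sum, ← Finset.sum_div, prodProb]
    refine add_le_add ?_ le_rfl
    calc (∑ x ∈ D, (∏ i, Q (x i)) * (∑ i, g P (x i)) ^ 2) / (n * δ) ^ 2
        ≤ (∑ x : Fin n → A, (∏ i, Q (x i)) * (∑ i, g P (x i)) ^ 2) / (n * δ) ^ 2 := by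
          gcongr
          · intro x _ _
            exact mul_nonneg (hw x) (sq_nonneg _)
          · exact Finset.subset_univ _
      _ = _ := by
          rw [(sum_prod_mul_sum_moments Q hQsum (g P) (hg P) n).2]
          field_simp
  have hsplit := Finset.sum_add_sum_compl C (fun x : Fin n → A => ∏ i, Q (x i))
  rw [sum_prod_eq_one Q hQsum n] at hsplit
  have h0 := part P₀ hP₀ C
  have h1 := part P₁ hP₁ Cᶜ
  rw [add_div, add_div]
  linarith

theorem stmt_15 {A : Type*} [Fintype A] [Nonempty A] [DecidableEq A]
    (P₀ P₁ : A → ℝ) (hP₀ : ∀ a, 0 < P₀ a) (hP₁ : ∀ a, 0 < P₁ a)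
    (hP₀sum : ∑ a, P₀ a = 1) (hP₁sum : ∑ a, P₁ a = 1)
    (r : ℝ) (hr : 0 < r) (hrH : r < relEnt P₁ P₀)
    (C : ∀ n : ℕ, Finset (Fin n → A))
    (halpha : Filter.limsup
      (fun n : ℕ => (1 / (n : ℝ)) * Real.logb 2 (prodProb P₀ n (C n)))
      atTop ≤ -r) :
    ((Filter.limsup
        (fun n : ℕ => -(1 / (n : ℝ)) * Real.logb 2 (prodProb P₁ n ((C n)ᶜ)))
        atTop : ℝ) : EReal) ≤
      sInf { x : EReal | ∃ Q : A → ℝ,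
        (∀ a, 0 ≤ Q a) ∧ (∑ a, Q a = 1) ∧
        relEnt Q P₀ < r ∧ x = ((relEnt Q P₁ : ℝ) : EReal) } := by
  refine le_sInf ?_
  rintro _ ⟨Q, hQ, hQsum, hQr, rfl⟩
  rw [EReal.coe_le_coe_iff]
  refine le_of_forall_pos_le_add fun ε hε => ?_
  obtain ⟨δ, hδ, hδε, hδr⟩ : ∃ δ : ℝ, 0 < δ ∧ 2 * δ ≤ ε ∧ 3 * δ ≤ r - relEnt Q P₀ :=
    ⟨min (ε / 2) ((r - relEnt Q P₀) / 3), lt_min (by linarith) (by linarith),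
      by linarith [min_le_left (ε / 2) ((r - relEnt Q P₀) / 3)],
      by linarith [min_le_right (ε / 2) ((r - relEnt Q P₀) / 3)]⟩
  obtain ⟨V, hV⟩ := one_le_change_of_measure P₀ P₁ Q hP₀ hP₁ hQ hQsum δ hδ
  have hα : ∀ᶠ n : ℕ in atTop,
      (1 / (n : ℝ)) * Real.logb 2 (prodProb P₀ n (C n)) < -(r - δ) := by
    refine eventually_lt_of_limsup_lt (by linarith) (isBoundedUnder_of ⟨0, fun n => ?_⟩)
    exact mul_nonpos_of_nonneg_of_nonpos (by positivity) (Real.logb_nonpos one_lt_two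
      (prodProb_nonneg P₀ hP₀ n _) (prodProb_le_one P₀ hP₀ hP₀sum n _))
  have hVn : ∀ᶠ n : ℕ in atTop, V / (n : ℝ) < 1 / 4 :=
    (tendsto_const_div_atTop_nhds_zero_nat V).eventually_lt_const (by norm_num)
  have hinv : ∀ᶠ n : ℕ in atTop, 1 / (n : ℝ) < δ :=
    (tendsto_const_div_atTop_nhds_zero_nat 1).eventually_lt_const hδ
  have hinv2 : ∀ᶠ n : ℕ in atTop, 2 / (n : ℝ) < δ :=
    (tendsto_const_div_atTop_nhds_zero_nat 2).eventually_lt_const hδ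
  refine limsup_le_of_le (isCoboundedUnder_le_of_le atTop (x := 0) fun n => ?_) ?_
  · rw [neg_mul, neg_nonneg]
    exact mul_nonpos_of_nonneg_of_nonpos (by positivity) (Real.logb_nonpos one_lt_two
      (prodProb_nonneg P₁ hP₁ n _) (prodProb_le_one P₁ hP₁ hP₁sum n _))
  filter_upwards [hα, hVn, hinv, hinv2, eventually_gt_atTop 0] with n hα hVn hinv hinv2 hn
  have hn' : (0 : ℝ) < n := by exact_mod_cast hn
  rw [div_lt_iff₀ hn'] at hinv2
  have hp : prodProb P₀ n (C n) ≤ 2 ^ (-(n * (r - δ))) := by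
    rcases (prodProb_nonneg P₀ hP₀ n (C n)).eq_or_lt with h | h
    · rw [← h]; positivity
    · rw [← Real.logb_le_iff_le_rpow one_lt_two h]
      rw [one_div, inv_mul_lt_iff₀ hn'] at hα
      linarith
  have hsmall : (2 : ℝ) ^ (n * (relEnt Q P₀ + δ)) * prodProb P₀ n (C n) ≤ 1 / 4 := by
    calc _ ≤ (2 : ℝ) ^ (n * (relEnt Q P₀ + δ)) * 2 ^ (-(n * (r - δ))) := by gcongr
      _ = 2 ^ (n * (relEnt Q P₀ + δ) + -(n * (r - δ))) := (Real.rpow_add two_pos _ _).symm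
      _ ≤ 2 ^ (-2 : ℝ) := by
        refine Real.rpow_le_rpow_of_exponent_le one_le_two ?_
        nlinarith
      _ = 1 / 4 := by norm_num [Real.rpow_neg]
  have hbig : 1 / 2 ≤ (2 : ℝ) ^ (n * (relEnt Q P₁ + δ)) * prodProb P₁ n (C n)ᶜ := by
    linarith [hV n hn (C n)]
  have hβ : 0 < prodProb P₁ n (C n)ᶜ :=
    pos_of_mul_pos_right (lt_of_lt_of_le (by norm_num) hbig) (by positivity)
  have hlog := Real.logb_le_logb_of_le one_lt_two (by norm_num) hbig
  rw [Real.logb_mul (by positivity) hβ.ne', Real.logb_rpow two_pos (by norm_num), one_div,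
    Real.logb_inv, Real.logb_self_eq_one one_lt_two] at hlog
  rw [neg_mul, neg_le, one_div, le_inv_mul_iff₀ hn']
  rw [div_lt_iff₀ hn'] at hinv
  nlinarith
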